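/- arXiv:1412.3006 — 2 statements merged into one kernel-verified Lean document; each statement's English description precedes it below -/
import Mathlib

section
/- Assume λ: H^n → ZMod 2 with λ(0^n) = 0 is nonlinear (there exist y_1, y_2 ∈ H^n with λ(y_1 + y_2) ≠ λ(y_1) + λ(y_2)), pierces R_j^n for every 1 ≤ j ≤ n, and the number of codewords y ∈ H^n with λ(y) = 0 differs from the number with λ(y) = 1. For each length m occurring in the recursion, let T_m = {y' ∈ H^m : (y', λ_m(y'), 0^m) ∈ Tr(V_{H^m}^{λ_m})}. Then for every length N = 2m+1 occurring in the recursion with N > n, T_N = {(y, 0^{m+1}) + v : y ∈ T_m, v ∈ R_{m+1}^N}, i.e., T_N is the union of the cosets of R_{m+1}^N whose representatives are the embedded elements of T_m (where m = (N−1)/2). -/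
set_option linter.unusedSectionVars false

/-- Binary vectors of length `|ι|`, indexed by `ι`. -/
abbrev F (ι : Type*) : Type _ := ι → ZMod 2

section Defs

variable {ι : Type*}

/-- The support of a vector: the set of its nonzero coordinate positions. -/
def supp (x : F ι) : Set ι := {i | x i ≠ 0}

/-- Action of a permutation on binary vectors by permuting coordinates:
`(permAct π x) (π i) = x i`. -/
def permAct (π : Equiv.Perm ι) (x : F ι) : F ι := x ∘ π.symm

/-- The image `π(C)` of a code under a coordinate permutation. -/
def permCode (π : Equiv.Perm ι) (C : Set (F ι)) : Set (F ι) := permAct π '' C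

/-- The translateCode `y + C` of a code. -/
def translateCode (y : F ι) (C : Set (F ι)) : Set (F ι) := (y + ·) '' C

/-- `Sym(C) = {π : π(C) = C}`. -/
def SymSet (C : Set (F ι)) : Set (Equiv.Perm ι) := {π | permCode π C = C}

/-- `Rot(C) = {π : ∃ y ∈ C, y + π(C) = C}`. -/
def RotSet (C : Set (F ι)) : Set (Equiv.Perm ι) :=
  {π | ∃ y ∈ C, translateCode y (permCode π C) = C}

/-- `Rot_y(C) = {π : y + π(C) = C}`. -/
def RotAt (C : Set (F ι)) (y : F ι) : Set (Equiv.Perm ι) :=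
  {π | translateCode y (permCode π C) = C}

/-- `Tr(C) = {y ∈ C : ∃ π, y + π(C) = C}`. -/
def TrSet (C : Set (F ι)) : Set (F ι) :=
  {y | y ∈ C ∧ ∃ π : Equiv.Perm ι, translateCode y (permCode π C) = C}

/-- `Ker(C) = {x ∈ C : x + C = C}`. -/
def KerSet (C : Set (F ι)) : Set (F ι) := {x | x ∈ C ∧ translateCode x C = C}

/-- `Aut(C) = {(y, π) : y + π(C) = C}`. -/
def AutSet (C : Set (F ι)) : Set (F ι × Equiv.Perm ι) :=
  {p | translateCode p.1 (permCode p.2 C) = C}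

/-- A (reduced) code is transitive if for every codeword `y` there is a permutation `π`
with `y + π(C) = C`. -/
def IsTransitive (C : Set (F ι)) : Prop :=
  ∀ y ∈ C, ∃ π : Equiv.Perm ι, translateCode y (permCode π C) = C

/-- A code is propelinear if `Aut(C)` contains a subgroup acting regularly on `C`
(the group law is `(y, π) * (y', π') = (y + π(y'), π ∘ π')`, acting by `(y,π) • x = y + π(x)`). -/
def IsPropelinear (C : Set (F ι)) : Prop :=
  ∃ A : Set (F ι × Equiv.Perm ι),
    (∀ a ∈ A, translateCode a.1 (permCode a.2 C) = C) ∧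
    ((0, 1) ∈ A) ∧
    (∀ a ∈ A, ∀ b ∈ A, (a.1 + permAct a.2 b.1, a.2 * b.2) ∈ A) ∧
    (∀ a ∈ A, (permAct a.2⁻¹ a.1, a.2⁻¹) ∈ A) ∧
    (∀ c ∈ C, ∀ c' ∈ C, ∃! a, a ∈ A ∧ a.1 + permAct a.2 c = c')

variable [Fintype ι] [DecidableEq ι]

/-- A perfect (1-error-correcting) code: every vector is within Hamming distance 1 of
exactly one codeword. -/
def IsPerfect (C : Set (F ι)) : Prop :=
  ∀ x : F ι, ∃! c, c ∈ C ∧ hammingDist x c ≤ 1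

/-- `STS(C, y) = {supp (x + y) : x ∈ C, d(x, y) = 3}`. -/
def STS (C : Set (F ι)) (y : F ι) : Set (Set ι) :=
  {s | ∃ x ∈ C, hammingDist x y = 3 ∧ s = supp (x + y)}

/-- A reduced perfect code is homogeneous if each `STS(C,y)`, `y ∈ C`, is isomorphic
to `STS(C, 0)`. -/
def IsHomogeneous (C : Set (F ι)) : Prop :=
  ∀ y ∈ C, ∃ π : Equiv.Perm ι, (Set.image π) '' (STS C y) = STS C (0 : F ι)

/-- The (mod 2) weight `|x| = x_1 + ⋯ + x_n`. -/
def wt (x : F ι) : ZMod 2 := ∑ i, x i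

/-- The scalar product `u · y = Σ u_i y_i (mod 2)`. -/
def dot (u y : F ι) : ZMod 2 := ∑ i, u i * y i

/-- A linear code: a subspace of `F ι` (over `ZMod 2` it suffices to be closed under `+`). -/
def IsLinearCode (C : Set (F ι)) : Prop :=
  (0 : F ι) ∈ C ∧ ∀ x ∈ C, ∀ y ∈ C, x + y ∈ C

/-- A Hamming code: a linear perfect code. -/
def IsHammingCode (C : Set (F ι)) : Prop := IsLinearCode C ∧ IsPerfect C

/-- The `i`-component `R_i`: the linear span of the weight-3 codewords of `H` whose
support contains `i`. -/
def component (H : Set (F ι)) (i : ι) : Set (F ι) :=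
  ↑(Submodule.span (ZMod 2) {x | x ∈ H ∧ hammingNorm x = 3 ∧ x i ≠ 0})

/-- `lam` pierces `R` if it takes both values 0 and 1 on `R`. -/
def Pierces (lam : F ι → ZMod 2) (R : Set (F ι)) : Prop :=
  (∃ x ∈ R, lam x = 0) ∧ (∃ x ∈ R, lam x = 1)

/-- The vector `(a, b, c)` of length `2n+1`: coordinates `1..n` are `a`, coordinate `n+1`
is `b`, coordinates `n+2..2n+1` are `c`. -/
def vasVec (a : F ι) (b : ZMod 2) (c : F ι) : F (ι ⊕ Unit ⊕ ι) :=
  Sum.elim a (Sum.elim (fun _ => b) c)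

/-- The Vasil'ev code `V_C^λ = {(x + y, |x| + λ(y), x) : x ∈ F^n, y ∈ C}`. -/
def Vasiliev (C : Set (F ι)) (lam : F ι → ZMod 2) : Set (F (ι ⊕ Unit ⊕ ι)) :=
  {v | ∃ x : F ι, ∃ y ∈ C, v = vasVec (x + y) (wt x + lam y) x}

/-- The subspace `R_{n+1}^{2n+1} = {(x, |x|, x) : x ∈ F^n}`. -/
def Rmid : Set (F (ι ⊕ Unit ⊕ ι)) := {v | ∃ x : F ι, v = vasVec x (wt x) x}

/-- Underlying function of `τ_u`: swaps positions `i` and `i + n + 1` for `i ∈ supp u`. -/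
def tauFun (u : F ι) : (ι ⊕ Unit ⊕ ι) → (ι ⊕ Unit ⊕ ι)
  | Sum.inl i => if u i ≠ 0 then Sum.inr (Sum.inr i) else Sum.inl i
  | Sum.inr (Sum.inl _) => Sum.inr (Sum.inl ())
  | Sum.inr (Sum.inr i) => if u i ≠ 0 then Sum.inl i else Sum.inr (Sum.inr i)

theorem tauFun_involutive (u : F ι) : Function.Involutive (tauFun u) := by
  intro x
  rcases x with i | x
  · by_cases h : u i = 0 <;> simp [tauFun, h]
  · rcases x with u' | i
    · simp [tauFun]
    · by_cases h : u i = 0 <;> simp [tauFun, h]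

/-- The permutation `τ_u`: the product of transpositions `(i, i+n+1)` over `i ∈ supp u`. -/
def tau (u : F ι) : Equiv.Perm (ι ⊕ Unit ⊕ ι) :=
  Function.Involutive.toPerm (tauFun u) (tauFun_involutive u)

/-- The duplicator `σ_π`: fixes position `n+1`, sends `i ↦ π(i)` and `i+n+1 ↦ π(i)+n+1`. -/
def dup (π : Equiv.Perm ι) : Equiv.Perm (ι ⊕ Unit ⊕ ι) :=
  Equiv.sumCongr π (Equiv.sumCongr (Equiv.refl Unit) π)

/-- The extension of `λ` one step up the Vasil'ev recursion: `λ'(z) = λ(y)` for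
`z ∈ (y, 0^{m+1}) + R_{m+1}^{2m+1}` (well defined by recovering `y` from `z`). -/
def lamSucc (lam : F ι → ZMod 2) : F (ι ⊕ Unit ⊕ ι) → ZMod 2 :=
  fun z => lam (fun i => z (Sum.inl i) + z (Sum.inr (Sum.inr i)))

/-- `T = {y' ∈ H : (y', λ(y'), 0) ∈ Tr(V_H^λ)}`. -/
def Tset (H : Set (F ι)) (lam : F ι → ZMod 2) : Set (F ι) :=
  {y' | y' ∈ H ∧ vasVec y' (lam y') 0 ∈ TrSet (Vasiliev H lam)}

/-- The Assmus–Mattson Steiner triple system `S^θ` of order `2n+1`. -/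
def AM (S : Set (Set ι)) (θ : Set ι → ZMod 2) : Set (Set (ι ⊕ Unit ⊕ ι)) :=
  {T | (∃ i : ι, T = {Sum.inl i, Sum.inr (Sum.inl ()), Sum.inr (Sum.inr i)}) ∨
    (∃ s ∈ S, θ s = 0 ∧
      (T = Sum.inl '' s ∨
        ∃ a ∈ s, T = insert (Sum.inl a) ((fun i => Sum.inr (Sum.inr i)) '' (s \ {a})))) ∨
    (∃ s ∈ S, θ s = 1 ∧
      (T = (fun i => Sum.inr (Sum.inr i)) '' s ∨
        ∃ a ∈ s, T = insert (Sum.inr (Sum.inr a)) (Sum.inl '' (s \ {a}))))}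

end Defs

/-- A Steiner triple system on the point set `α`. -/
def IsSTS {α : Type*} (S : Set (Set α)) : Prop :=
  (∀ s ∈ S, s.ncard = 3) ∧ ∀ i j : α, i ≠ j → ∃! s, s ∈ S ∧ i ∈ s ∧ j ∈ s

/-- The Mollard code (with zero function) of the codes `C` and `D`. -/
def Mollard {t r : Type*} [Fintype t] [Fintype r] (C : Set (F t)) (D : Set (F r)) :
    Set (F ((t × r) ⊕ t ⊕ r)) :=
  {v | ∃ x : F (t × r), ∃ c ∈ C, ∃ d ∈ D,
    v = Sum.elim x (Sum.elim (fun i => c i + ∑ j, x (i, j)) (fun j => d j + ∑ i, x (i, j)))}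

/-- Index types of the iterated Vasil'ev construction: lengths `n`, `2n+1`, `4n+3`, …. -/
def HType (n : ℕ) : ℕ → Type
  | 0 => Fin n
  | s + 1 => HType n s ⊕ Unit ⊕ HType n s

def HType.ft (n : ℕ) : ∀ s, Fintype (HType n s)
  | 0 => inferInstanceAs (Fintype (Fin n))
  | s + 1 =>
      letI := HType.ft n s
      inferInstanceAs (Fintype (HType n s ⊕ Unit ⊕ HType n s))

instance (n s : ℕ) : Fintype (HType n s) := HType.ft n s

def HType.deq (n : ℕ) : ∀ s, DecidableEq (HType n s)
  | 0 => inferInstanceAs (DecidableEq (Fin n))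
  | s + 1 =>
      letI := HType.deq n s
      inferInstanceAs (DecidableEq (HType n s ⊕ Unit ⊕ HType n s))

instance (n s : ℕ) : DecidableEq (HType n s) := HType.deq n s

/-- The iterated Hamming codes `H^n, H^{2n+1} = V_{H^n}^0, H^{4n+3}, …`. -/
def Hcode (n : ℕ) (H : Set (F (Fin n))) : ∀ s, Set (F (HType n s))
  | 0 => H
  | s + 1 => Vasiliev (Hcode n H s) 0

/-- The iterated functions `λ_n = λ`, `λ_{2m+1}` extending `λ_m`. -/
def lamIter (n : ℕ) (lam : F (Fin n) → ZMod 2) : ∀ s, F (HType n s) → ZMod 2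
  | 0 => lam
  | s + 1 => lamSucc (lamIter n lam s)

/-- `C_0 = V_{H^n}^λ`, `C_{s+1} = V_{C_s}^0`. -/
def Ccode (n : ℕ) (H : Set (F (Fin n))) (lam : F (Fin n) → ZMod 2) :
    ∀ s, Set (F (HType n (s + 1)))
  | 0 => Vasiliev H lam
  | s + 1 => Vasiliev (Ccode n H lam s) 0

section HammingAxioms

variable {ι κ : Type*}

theorem F.add_self (x : F ι) : x + x = 0 := by
  funext i
  exact CharTwo.add_self_eq_zero (x i)

theorem F.add_cancel_left (x y : F ι) : x + (x + y) = y := by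
  rw [← add_assoc, F.add_self, zero_add]

theorem F.eq_of_add_eq_zero {x y : F ι} (h : x + y = 0) : x = y := by
  have := F.add_cancel_left x y
  rwa [h, add_zero] at this

theorem ZMod.two_eq_zero_or_one (a : ZMod 2) : a = 0 ∨ a = 1 := by
  revert a
  decide

variable [DecidableEq ι] [DecidableEq κ]

/-- The properties of Hamming codes used below: linearity, covering radius at most one, and
absence of words of weight one and two. -/
structure IsHam (C : Set (F ι)) : Prop where
  zero : (0 : F ι) ∈ C
  add : ∀ {x y}, x ∈ C → y ∈ C → x + y ∈ C
  cover : ∀ x : F ι, x ∈ C ∨ ∃ k, x + Pi.single k 1 ∈ C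
  single_notMem : ∀ k, (Pi.single k 1 : F ι) ∉ C
  pair : ∀ {i j}, (Pi.single i 1 + Pi.single j 1 : F ι) ∈ C → i = j

theorem single_one_inj {i j : ι} (h : (Pi.single i 1 : F ι) = Pi.single j 1) : i = j := by
  by_contra hij
  have := congrFun h i
  simp [hij] at this

/-- A vector of weight at most one. -/
def IsUnitOrZero (x : F ι) : Prop := x = 0 ∨ ∃ i, x = Pi.single i 1

theorem IsUnitOrZero.single (i : ι) : IsUnitOrZero (Pi.single i 1 : F ι) := Or.inr ⟨i, rfl⟩

namespace IsHam

variable {C : Set (F ι)}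

theorem add_mem_iff (hC : IsHam C) {x y : F ι} (hx : x ∈ C) : x + y ∈ C ↔ y ∈ C := by
  refine ⟨fun h => ?_, hC.add hx⟩
  have := hC.add hx h
  rwa [F.add_cancel_left] at this

theorem eq_of_add_mem (hC : IsHam C) {x y : F ι} (hx : IsUnitOrZero x) (hy : IsUnitOrZero y)
    (h : x + y ∈ C) : x = y := by
  rcases hx with rfl | ⟨i, rfl⟩ <;> rcases hy with rfl | ⟨j, rfl⟩
  · rfl
  · rw [zero_add] at h
    exact absurd h (hC.single_notMem j)
  · rw [add_zero] at h
    exact absurd h (hC.single_notMem i)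
  · rw [hC.pair h]

theorem exists_triple (hC : IsHam C) {i j : ι} (hij : i ≠ j) :
    ∃ k, (Pi.single i 1 + Pi.single j 1 + Pi.single k 1 : F ι) ∈ C :=
  (hC.cover _).resolve_left fun h => hij (hC.pair h)

end IsHam

theorem eq_or_exists_of_hammingDist_le_one [Fintype ι] {x c : F ι} (h : hammingDist x c ≤ 1) :
    x = c ∨ ∃ k, x = c + Pi.single k 1 := by
  by_cases hxc : x = c
  · exact Or.inl hxc
  obtain ⟨k, hk⟩ := Function.ne_iff.mp hxc
  refine Or.inr ⟨k, funext fun j => ?_⟩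
  rw [hammingDist, Finset.card_le_one] at h
  by_cases hj : j = k
  · subst hj
    simp only [Pi.add_apply, Pi.single_eq_same]
    generalize x j = a at hk
    generalize c j = b at hk
    revert a b
    decide
  · by_contra hne
    simp only [Pi.add_apply, Pi.single_apply, hj, if_false, add_zero] at hne
    exact hj (h j (by simpa using hne) k (by simpa using hk))

theorem hammingDist_add_single_le_one [Fintype ι] (c : F ι) (k : ι) :
    hammingDist (c + Pi.single k 1) c ≤ 1 := by
  rw [hammingDist, Finset.card_le_one]
  intro a ha b hb
  simp only [Pi.add_apply, ne_eq, add_eq_left, Pi.single_apply, Finset.mem_filter,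
    Finset.mem_univ, true_and, ite_eq_right_iff, one_ne_zero, imp_false, not_not] at ha hb
  rw [ha, hb]

theorem IsHammingCode.isHam [Fintype ι] {C : Set (F ι)} (hC : IsHammingCode C) : IsHam C := by
  obtain ⟨⟨h0, hadd⟩, hperf⟩ := hC
  refine ⟨h0, fun hx hy => hadd _ hx _ hy, fun x => ?_, fun k hk => ?_, fun {i j} hij => ?_⟩
  · obtain ⟨c, ⟨hc, hd⟩, -⟩ := hperf x
    rcases eq_or_exists_of_hammingDist_le_one hd with rfl | ⟨k, rfl⟩
    · exact Or.inl hc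
    · refine Or.inr ⟨k, ?_⟩
      rwa [add_assoc, F.add_self, add_zero]
  · have h1 := hammingDist_add_single_le_one (0 : F ι) k
    rw [zero_add, hammingDist_comm] at h1
    have := (hperf 0).unique ⟨h0, by simp⟩ ⟨hk, h1⟩
    simpa using congrFun this k
  · have h1 := hammingDist_add_single_le_one (Pi.single i 1 : F ι) j
    rw [hammingDist_comm] at h1
    have h2 := hammingDist_add_single_le_one (0 : F ι) i
    rw [zero_add] at h2
    have := (hperf (Pi.single i 1)).unique ⟨h0, h2⟩ ⟨hij, h1⟩
    exact single_one_inj (F.eq_of_add_eq_zero this.symm)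

theorem exists_eq_three_singles [Fintype ι] {x : F ι} {i : ι} (h3 : hammingNorm x = 3)
    (hi : x i ≠ 0) : ∃ a b, x = Pi.single i 1 + Pi.single a 1 + Pi.single b 1 := by
  set S : Finset ι := {j | x j ≠ 0} with hS
  have hiS : i ∈ S := by simpa [hS] using hi
  have hcard : (S.erase i).card = 2 := by
    rw [Finset.card_erase_of_mem hiS]
    change hammingNorm x - 1 = 2
    rw [h3]
  obtain ⟨a, b, hab, hE⟩ := Finset.card_eq_two.mp hcard
  refine ⟨a, b, funext fun j => ?_⟩
  have hmem : ∀ j, j ≠ i ∧ x j ≠ 0 ↔ j = a ∨ j = b := fun j => by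
    have := Finset.ext_iff.mp hE j
    simpa [hS] using this
  have ha := (hmem a).mpr (Or.inl rfl)
  have hb := (hmem b).mpr (Or.inr rfl)
  have hone : ∀ j, x j ≠ 0 → x j = 1 := fun j => (ZMod.two_eq_zero_or_one (x j)).resolve_left
  simp only [Pi.add_apply, Pi.single_apply]
  by_cases h1 : j = i
  · subst h1
    simp [hone _ hi, ha.1.symm, hb.1.symm]
  by_cases h2 : j = a
  · subst h2
    simp [hone _ ha.2, h1, hab]
  by_cases h4 : j = b
  · subst h4
    simp [hone _ hb.2, h1, h2]
  · have := (hmem j).not.mpr (by tauto)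
    simp only [h1, h2, h4, if_false, add_zero]
    tauto

end HammingAxioms

section Permutations

variable {ι κ : Type*}

theorem permAct_add (π : Equiv.Perm ι) (x y : F ι) :
    permAct π (x + y) = permAct π x + permAct π y := rfl

theorem permAct_injective (π : Equiv.Perm ι) : Function.Injective (permAct π) :=
  π.symm.surjective.injective_comp_right

theorem permAct_single [DecidableEq ι] (π : Equiv.Perm ι) (i : ι) :
    permAct π (Pi.single i 1) = Pi.single (π i) 1 := by
  funext j
  simp [permAct, Pi.single_apply, Equiv.symm_apply_eq]

/-- `permAct` as a linear map. -/
def permLin (π : Equiv.Perm ι) : F ι →ₗ[ZMod 2] F ι := LinearMap.funLeft (ZMod 2) (ZMod 2) π.symm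

@[simp]
theorem permLin_apply (π : Equiv.Perm ι) (x : F ι) : permLin π x = permAct π x := rfl

theorem exists_permAct_eq [Finite ι] {π : Equiv.Perm ι} {C : Set (F ι)}
    (h : ∀ x ∈ C, permAct π x ∈ C) {y : F ι} (hy : y ∈ C) : ∃ x ∈ C, permAct π x = y := by
  have := Set.eq_of_subset_of_ncard_le (Set.image_subset_iff.mpr h)
    (Set.ncard_image_of_injective C (permAct_injective π)).ge (Set.toFinite C)
  rw [← this] at hy
  exact hy

theorem permAct_comm [Finite ι] [DecidableEq ι] (P : F ι →ₗ[ZMod 2] F κ) (π : Equiv.Perm ι)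
    (ρ : Equiv.Perm κ)
    (h : ∀ i, P (Pi.single (π i) 1) = permAct ρ (P (Pi.single i 1))) (w : F ι) :
    P (permAct π w) = permAct ρ (P w) := by
  have : P ∘ₗ permLin π = permLin ρ ∘ₗ P := by
    refine LinearMap.pi_ext' fun i => LinearMap.ext_ring ?_
    simpa [permAct_single] using h i
  exact LinearMap.congr_fun this w

/-- A permutation-and-linear-functional form of the condition defining `Tset`. -/
def IsRotation (H : Set (F ι)) (lam : F ι → ZMod 2) (y' : F ι) : Prop :=
  y' ∈ H ∧ ∃ (ρ : Equiv.Perm ι) (l : F ι →ₗ[ZMod 2] ZMod 2), ∀ y ∈ H,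
    permAct ρ y ∈ H ∧ lam (y' + permAct ρ y) = lam y' + lam y + l y

end Permutations

section VasilievStep

variable {ι : Type*}

/-- The projection `(a, b, c) ↦ a + c`. -/
def fold : F (ι ⊕ Unit ⊕ ι) →ₗ[ZMod 2] F ι :=
  LinearMap.funLeft (ZMod 2) (ZMod 2) Sum.inl +
    LinearMap.funLeft (ZMod 2) (ZMod 2) (Sum.inr ∘ Sum.inr)

/-- The projection `(a, b, c) ↦ c`. -/
def rightPart : F (ι ⊕ Unit ⊕ ι) →ₗ[ZMod 2] F ι :=
  LinearMap.funLeft (ZMod 2) (ZMod 2) (Sum.inr ∘ Sum.inr)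

/-- The embedding `y ↦ (y, 0, 0)`. -/
def embedLeft : F ι →ₗ[ZMod 2] F (ι ⊕ Unit ⊕ ι) where
  toFun y := vasVec y 0 0
  map_add' x y := by
    funext j
    rcases j with j | j | j <;> simp [vasVec]
  map_smul' c x := by
    funext j
    rcases j with j | j | j <;> simp [vasVec]

theorem embedLeft_apply (y : F ι) : embedLeft y = vasVec y 0 0 := rfl

@[simp]
theorem fold_apply (w : F (ι ⊕ Unit ⊕ ι)) (i : ι) :
    fold w i = w (Sum.inl i) + w (Sum.inr (Sum.inr i)) := rfl

@[simp]
theorem rightPart_apply (w : F (ι ⊕ Unit ⊕ ι)) (i : ι) :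
    rightPart w i = w (Sum.inr (Sum.inr i)) := rfl

@[simp]
theorem fold_vasVec (a c : F ι) (b : ZMod 2) : fold (vasVec a b c) = a + c := rfl

@[simp]
theorem rightPart_vasVec (a c : F ι) (b : ZMod 2) : rightPart (vasVec a b c) = c := rfl

@[simp]
theorem vasVec_mid (a c : F ι) (b : ZMod 2) (t : Unit) : vasVec a b c (Sum.inr (Sum.inl t)) = b := rfl

section Singles

variable [DecidableEq ι]

@[simp]
theorem fold_single_inl (i : ι) : fold (Pi.single (Sum.inl i) 1) = (Pi.single i 1 : F ι) := by
  funext j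
  simp [Pi.single_apply]

@[simp]
theorem fold_single_mid (t : Unit) : fold (Pi.single (Sum.inr (Sum.inl t)) 1) = (0 : F ι) := by
  funext j
  simp

@[simp]
theorem fold_single_inr (i : ι) :
    fold (Pi.single (Sum.inr (Sum.inr i)) 1) = (Pi.single i 1 : F ι) := by
  funext j
  simp [Pi.single_apply]

@[simp]
theorem rightPart_single_inl (i : ι) : rightPart (Pi.single (Sum.inl i) 1) = (0 : F ι) := by
  funext j
  simp

@[simp]
theorem rightPart_single_mid (t : Unit) :
    rightPart (Pi.single (Sum.inr (Sum.inl t)) 1) = (0 : F ι) := by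
  funext j
  simp

@[simp]
theorem rightPart_single_inr (i : ι) :
    rightPart (Pi.single (Sum.inr (Sum.inr i)) 1) = (Pi.single i 1 : F ι) := by
  funext j
  simp [Pi.single_apply]

theorem isUnitOrZero_fold_single (a : ι ⊕ Unit ⊕ ι) :
    IsUnitOrZero (fold (Pi.single a 1) : F ι) := by
  rcases a with i | ⟨⟩ | i
  · exact Or.inr ⟨i, fold_single_inl i⟩
  · exact Or.inl (fold_single_mid _)
  · exact Or.inr ⟨i, fold_single_inr i⟩

end Singles

variable [Fintype ι]

@[simp]
theorem wt_zero : wt (0 : F ι) = 0 := by simp [wt]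

theorem wt_add (x y : F ι) : wt (x + y) = wt x + wt y := by simp [wt, Finset.sum_add_distrib]

@[simp]
theorem wt_single [DecidableEq ι] (i : ι) : wt (Pi.single i 1 : F ι) = 1 := by simp [wt]

theorem wt_permAct (ρ : Equiv.Perm ι) (x : F ι) : wt (permAct ρ x) = wt x :=
  Equiv.sum_comp ρ.symm x

/-- `wt` as a linear map. -/
def wtLin : F ι →ₗ[ZMod 2] ZMod 2 where
  toFun := wt
  map_add' := wt_add
  map_smul' c x := by simp [wt, Finset.mul_sum]

theorem wtLin_apply (x : F ι) : wtLin x = wt x := rfl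

theorem mem_Vasiliev {C : Set (F ι)} {lam : F ι → ZMod 2} {w : F (ι ⊕ Unit ⊕ ι)} :
    w ∈ Vasiliev C lam ↔
      fold w ∈ C ∧ w (Sum.inr (Sum.inl ())) = wt (rightPart w) + lam (fold w) := by
  constructor
  · rintro ⟨x, y, hy, rfl⟩
    have h : fold (vasVec (x + y) (wt x + lam y) x) = y := by
      rw [fold_vasVec, add_comm, F.add_cancel_left]
    rw [h, rightPart_vasVec, vasVec_mid]
    exact ⟨hy, rfl⟩
  · rintro ⟨h1, h2⟩
    refine ⟨rightPart w, fold w, h1, funext fun j => ?_⟩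
    rcases j with j | ⟨⟩ | j
    · have h : w (Sum.inl j) = w (Sum.inr (Sum.inr j)) +
          (w (Sum.inl j) + w (Sum.inr (Sum.inr j))) := by
        generalize w (Sum.inl j) = a
        generalize w (Sum.inr (Sum.inr j)) = b
        revert a b
        decide
      exact h
    · exact h2
    · rfl

theorem IsHam.vasiliev [DecidableEq ι] {C : Set (F ι)} (hC : IsHam C) :
    IsHam (Vasiliev C 0) where
  zero := by simp [mem_Vasiliev, hC.zero]
  add {x y} hx hy := by
    rw [mem_Vasiliev] at *
    refine ⟨by simpa using hC.add hx.1 hy.1, ?_⟩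
    simp [hx.2, hy.2, wt_add]
  cover x := by
    simp only [mem_Vasiliev, Pi.zero_apply, add_zero, map_add, Pi.add_apply, wt_add]
    rcases hC.cover (fold x) with h | ⟨k, h⟩
    · by_cases hx : x (Sum.inr (Sum.inl ())) = wt (rightPart x)
      · exact Or.inl ⟨h, hx⟩
      · refine Or.inr ⟨Sum.inr (Sum.inl ()), by simpa using h, ?_⟩
        simp only [Pi.single_eq_same, rightPart_single_mid, wt_zero, add_zero]
        generalize x (Sum.inr (Sum.inl ())) = a at hx
        generalize wt (rightPart x) = b at hx
        revert a b
        decide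
    · right
      by_cases hx : x (Sum.inr (Sum.inl ())) = wt (rightPart x)
      · exact ⟨Sum.inl k, by simpa using h, by simpa using hx⟩
      · refine ⟨Sum.inr (Sum.inr k), by simpa using h, ?_⟩
        simp only [ne_eq, Sum.inr.injEq, reduceCtorEq, not_false_eq_true, Pi.single_eq_of_ne,
          rightPart_single_inr, wt_single, add_zero]
        generalize x (Sum.inr (Sum.inl ())) = a at hx
        generalize wt (rightPart x) = b at hx
        revert a b
        decide
  single_notMem a := by
    rw [mem_Vasiliev]
    rintro ⟨h1, h2⟩
    rcases a with i | ⟨⟩ | i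
    · exact hC.single_notMem i (by simpa using h1)
    · simp at h2
    · exact hC.single_notMem i (by simpa using h1)
  pair {a b} h := by
    rw [mem_Vasiliev, map_add] at h
    obtain ⟨h1, h2⟩ := h
    have h3 := hC.eq_of_add_mem (isUnitOrZero_fold_single a) (isUnitOrZero_fold_single b) h1
    rcases a with i | ⟨⟩ | i <;> rcases b with j | ⟨⟩ | j <;>
      simp only [fold_single_inl, fold_single_mid, fold_single_inr, eq_comm (a := (0 : F ι)),
        Pi.single_eq_zero_iff, one_ne_zero] at h3 <;>
      first
        | rfl
        | (cases single_one_inj h3; rfl)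
        | (simp at h2)

theorem mem_Tset_iff {H : Set (F ι)} {lam : F ι → ZMod 2} {y' : F ι} :
    y' ∈ Tset H lam ↔ y' ∈ H ∧ ∃ π : Equiv.Perm (ι ⊕ Unit ⊕ ι), ∀ w ∈ Vasiliev H lam,
      vasVec y' (lam y') 0 + permAct π w ∈ Vasiliev H lam := by
  constructor
  · rintro ⟨hy, -, π, hπ⟩
    refine ⟨hy, π, fun w hw => ?_⟩
    have : vasVec y' (lam y') 0 + permAct π w ∈
        translateCode (vasVec y' (lam y') 0) (permCode π (Vasiliev H lam)) :=
      ⟨_, ⟨w, hw, rfl⟩, rfl⟩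
    rwa [hπ] at this
  · rintro ⟨hy, π, hπ⟩
    refine ⟨hy, mem_Vasiliev.mpr (by simpa using hy), π, ?_⟩
    rw [translateCode, permCode, Set.image_image]
    refine Set.eq_of_subset_of_ncard_le (Set.image_subset_iff.mpr hπ) ?_ (Set.toFinite _)
    rw [Set.ncard_image_of_injective]
    exact (add_right_injective _).comp (permAct_injective π)

theorem IsRotation.mem_Tset [DecidableEq ι] {H : Set (F ι)} {lam : F ι → ZMod 2} {y' : F ι}
    (hH : IsHam H) (h : IsRotation H lam y') : y' ∈ Tset H lam := by
  obtain ⟨hy', ρ, l, hl⟩ := h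
  set u : F ι := fun i => l (Pi.single i 1) with hu
  have hlu : ∀ y, l y = ∑ i, u i * y i := fun y => by
    conv_lhs => rw [pi_eq_sum_univ' y, map_sum]
    refine Finset.sum_congr rfl fun i _ => ?_
    rw [map_smul, smul_eq_mul, mul_comm]
  refine mem_Tset_iff.mpr ⟨hy', dup ρ * tau u, fun w hw => ?_⟩
  have hfold : fold (permAct (dup ρ * tau u) w) = permAct ρ (fold w) := by
    funext i
    change w (tauFun u (Sum.inl (ρ.symm i))) + w (tauFun u (Sum.inr (Sum.inr (ρ.symm i)))) =
      w (Sum.inl (ρ.symm i)) + w (Sum.inr (Sum.inr (ρ.symm i)))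
    by_cases h : u (ρ.symm i) = 0 <;> simp [tauFun, h, add_comm]
  have hright : rightPart (permAct (dup ρ * tau u) w) =
      permAct ρ (rightPart w + fun i => u i * fold w i) := by
    funext i
    change w (tauFun u (Sum.inr (Sum.inr (ρ.symm i)))) = w (Sum.inr (Sum.inr (ρ.symm i))) +
      u (ρ.symm i) * (w (Sum.inl (ρ.symm i)) + w (Sum.inr (Sum.inr (ρ.symm i))))
    rcases ZMod.two_eq_zero_or_one (u (ρ.symm i)) with h | h
    · simp [tauFun, h]
    · simp only [tauFun, h, ne_eq, one_ne_zero, not_false_eq_true, if_true, one_mul]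
      generalize w (Sum.inl (ρ.symm i)) = a
      generalize w (Sum.inr (Sum.inr (ρ.symm i))) = b
      revert a b
      decide
  have hmid : permAct (dup ρ * tau u) w (Sum.inr (Sum.inl ())) = w (Sum.inr (Sum.inl ())) := rfl
  rw [mem_Vasiliev] at hw ⊢
  obtain ⟨h1, h2⟩ := hw
  obtain ⟨h3, h4⟩ := hl _ h1
  simp only [map_add, fold_vasVec, rightPart_vasVec, add_zero, zero_add, hfold, hright,
    Pi.add_apply, vasVec_mid, hmid]
  refine ⟨hH.add hy' h3, ?_⟩
  rw [h4, h2, wt_permAct, wt_add, hlu]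
  change _ = _ + (∑ i, u i * fold w i) + _
  generalize ∑ i, u i * fold w i = a
  generalize wt (rightPart w) = b
  generalize lam (fold w) = c
  generalize lam y' = d
  revert a b c d
  decide

theorem isRotation_of_mem_Tset [DecidableEq ι] {H : Set (F ι)} {lam : F ι → ZMod 2} {y' : F ι}
    (hH : IsHam H) (hlam : lam 0 = 0)
    (hnl : ∃ y₁ ∈ H, ∃ y₂ ∈ H, lam (y₁ + y₂) ≠ lam y₁ + lam y₂)
    (h : y' ∈ Tset H lam) : IsRotation H lam y' := by
  obtain ⟨hy', π, hπ⟩ := mem_Tset_iff.mp h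
  have hfold : ∀ w ∈ Vasiliev H lam, fold (permAct π w) ∈ H := fun w hw => by
    have := (mem_Vasiliev.mp (hπ w hw)).1
    rw [map_add, fold_vasVec, add_zero] at this
    exact (hH.add_mem_iff hy').mp this
  have hlift : ∀ y ∈ H, vasVec y (lam y) 0 ∈ Vasiliev H lam := fun y hy =>
    mem_Vasiliev.mpr (by simpa using hy)
  have hmid : π (Sum.inr (Sum.inl ())) = Sum.inr (Sum.inl ()) := by
    obtain ⟨y₁, h₁, y₂, h₂, hne⟩ := hnl
    have hsum : vasVec y₁ (lam y₁) 0 + vasVec y₂ (lam y₂) 0 +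
        vasVec (y₁ + y₂) (lam (y₁ + y₂)) 0 = Pi.single (Sum.inr (Sum.inl ())) 1 := by
      funext j
      rcases j with j | ⟨⟩ | j
      · exact congrFun (F.add_self (y₁ + y₂)) j
      · simp only [Pi.add_apply, vasVec_mid, Pi.single_eq_same]
        generalize lam (y₁ + y₂) = a at hne
        generalize lam y₁ = b at hne
        generalize lam y₂ = c at hne
        revert a b c
        decide
      · simp [vasVec]
    have hmem := hH.add (hH.add (hfold _ (hlift _ h₁)) (hfold _ (hlift _ h₂)))
      (hfold _ (hlift _ (hH.add h₁ h₂)))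
    rw [← map_add, ← map_add, ← permAct_add, ← permAct_add, hsum, permAct_single] at hmem
    rcases hc : π (Sum.inr (Sum.inl ())) with i | ⟨⟩ | i
    · rw [hc, fold_single_inl] at hmem
      exact absurd hmem (hH.single_notMem i)
    · rfl
    · rw [hc, fold_single_inr] at hmem
      exact absurd hmem (hH.single_notMem i)
  have hline : ∀ i, fold (Pi.single (π (Sum.inl i)) 1) =
      (fold (Pi.single (π (Sum.inr (Sum.inr i))) 1) : F ι) := fun i => by
    have hmem := hfold (Pi.single (Sum.inl i) 1 + Pi.single (Sum.inr (Sum.inl ())) 1 +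
      Pi.single (Sum.inr (Sum.inr i)) 1) (mem_Vasiliev.mpr ?_)
    · simp only [permAct_add, permAct_single, map_add, hmid, fold_single_mid, add_zero] at hmem
      exact hH.eq_of_add_mem (isUnitOrZero_fold_single _) (isUnitOrZero_fold_single _) hmem
    · simp [F.add_self, hH.zero, hlam]
  have hex : ∀ i, ∃ j, fold (Pi.single (π (Sum.inl i)) 1) = (Pi.single j 1 : F ι) := fun i => by
    rcases hc : π (Sum.inl i) with j | ⟨⟩ | j
    · exact ⟨j, fold_single_inl j⟩
    · rw [← hmid] at hc
      exact absurd (π.injective hc) (by simp)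
    · exact ⟨j, fold_single_inr j⟩
  choose r hr using hex
  have hr' : ∀ i, fold (Pi.single (π (Sum.inr (Sum.inr i))) 1) = (Pi.single (r i) 1 : F ι) :=
    fun i => (hline i).symm.trans (hr i)
  have hsurj : Function.Surjective r := fun j => by
    have hj : fold (Pi.single (π (π.symm (Sum.inl j))) 1) = (Pi.single j 1 : F ι) := by simp
    rcases hc : π.symm (Sum.inl j) with i | ⟨⟩ | i
    · rw [hc, hr] at hj
      exact ⟨i, single_one_inj hj⟩
    · rw [Equiv.symm_apply_eq, hmid] at hc
      exact absurd hc (by simp)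
    · rw [hc, hr'] at hj
      exact ⟨i, single_one_inj hj⟩
  set ρ : Equiv.Perm ι :=
    Equiv.ofBijective r ⟨Finite.injective_iff_surjective.mpr hsurj, hsurj⟩ with hρ
  have hcomm : ∀ w, fold (permAct π w) = permAct ρ (fold w) := permAct_comm fold π ρ fun a => by
    rcases a with i | ⟨⟩ | i
    · rw [hr, fold_single_inl, permAct_single]
      rfl
    · rw [hmid, fold_single_mid]
      rfl
    · rw [hr', fold_single_inr, permAct_single]
      rfl
  refine ⟨hy', ρ, wtLin ∘ₗ rightPart ∘ₗ permLin π ∘ₗ embedLeft, fun y hy => ?_⟩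
  have h1 := hfold _ (hlift y hy)
  have h2 := (mem_Vasiliev.mp (hπ _ (hlift y hy))).2
  rw [hcomm, fold_vasVec, add_zero] at h1
  refine ⟨h1, ?_⟩
  have hmid' : π.symm (Sum.inr (Sum.inl ())) = Sum.inr (Sum.inl ()) := by
    rw [Equiv.symm_apply_eq, hmid]
  have hsplit : rightPart (permAct π (vasVec y (lam y) 0)) =
      rightPart (permAct π (vasVec y 0 0)) := by
    funext i
    change vasVec y (lam y) 0 (π.symm (Sum.inr (Sum.inr i))) =
      vasVec y 0 0 (π.symm (Sum.inr (Sum.inr i)))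
    rcases hc : π.symm (Sum.inr (Sum.inr i)) with j | ⟨⟩ | j
    · rfl
    · rw [← hmid'] at hc
      exact absurd (π.symm.injective hc) (by simp)
    · rfl
  have hm : permAct π (vasVec y (lam y) 0) (Sum.inr (Sum.inl ())) = lam y := by
    change vasVec y (lam y) 0 (π.symm (Sum.inr (Sum.inl ()))) = lam y
    rw [hmid', vasVec_mid]
  simp only [map_add, fold_vasVec, rightPart_vasVec, add_zero, zero_add, hcomm, hsplit,
    Pi.add_apply, vasVec_mid, hm] at h2
  simp only [LinearMap.comp_apply, wtLin_apply, permLin_apply, embedLeft_apply]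
  rw [h2]
  generalize wt (rightPart (permAct π (vasVec y 0 0))) = a
  generalize lam (y' + permAct ρ y) = b
  revert a b
  decide

theorem IsRotation.lift [DecidableEq ι] {H : Set (F ι)} {lam : F ι → ZMod 2}
    {z : F (ι ⊕ Unit ⊕ ι)} (hz : z ∈ Vasiliev H 0) (h : IsRotation H lam (fold z)) :
    IsRotation (Vasiliev H 0) (lamSucc lam) z := by
  obtain ⟨-, ρ, l, hl⟩ := h
  refine ⟨hz, dup ρ, l ∘ₗ fold, fun w hw => ?_⟩
  obtain ⟨h1, h2⟩ := mem_Vasiliev.mp hw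
  obtain ⟨h3, h4⟩ := hl _ h1
  refine ⟨mem_Vasiliev.mpr ⟨h3, ?_⟩, ?_⟩
  · change w (Sum.inr (Sum.inl ())) = wt (permAct ρ (rightPart w)) + 0
    rw [wt_permAct]
    exact h2
  · have : fold (z + permAct (dup ρ) w) = fold z + permAct ρ (fold w) :=
      map_add fold z _
    change lam (fold (z + permAct (dup ρ) w)) = _
    rw [this, h4]
    rfl

end VasilievStep

section Descent

variable {ι κ : Type*} [Fintype ι] [DecidableEq ι] [Fintype κ] [DecidableEq κ]

theorem IsRotation.descend {G : Set (F ι)} {H : Set (F κ)} (hG : IsHam G) (hH : IsHam H)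
    {P : F ι →ₗ[ZMod 2] F κ} {E : F κ →ₗ[ZMod 2] F ι} (hPE : ∀ y, P (E y) = y)
    (hPG : ∀ w ∈ G, P w ∈ H) (hEH : ∀ y ∈ H, E y ∈ G)
    (hPu : ∀ j, IsUnitOrZero (P (Pi.single j 1)))
    (hPs : ∀ i, ∃ j, P (Pi.single j 1) = Pi.single i 1)
    {lam : F κ → ZMod 2} (hlam : lam 0 = 0)
    (hpierce : ∀ j, Pierces lam (component H j))
    (hcount : {y ∈ H | lam y = 0}.ncard ≠ {y ∈ H | lam y = 1}.ncard)
    {z : F ι} (h : IsRotation G (lam ∘ P) z) : IsRotation H lam (P z) := by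
  obtain ⟨hz, ρ, l, hl⟩ := h
  have hρ : ∀ w ∈ G, permAct ρ w ∈ G := fun w hw => (hl w hw).1
  -- `ρ` sends words of `G` in the kernel of `P` to words along which `lam ∘ P` is periodic.
  have hper : ∀ r ∈ G, P r = 0 → lam (P (permAct ρ r)) = 0 := by
    intro r hr hPr
    have key : ∀ y ∈ H, lam (y + P (permAct ρ r)) = lam y + l r := by
      intro y hy
      obtain ⟨a, ha, hay⟩ := exists_permAct_eq hρ ((hG.add_mem_iff hz).mpr (hEH y hy))
      have h1 := (hl a ha).2
      have h2 := (hl (a + r) (hG.add ha hr)).2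
      rw [permAct_add, hay, ← add_assoc, F.add_cancel_left] at h2
      rw [hay, F.add_cancel_left] at h1
      simp only [Function.comp_apply, map_add, hPE, hPr, add_zero] at h1 h2
      rw [h1, h2, add_assoc (_ + _)]
    rcases ZMod.two_eq_zero_or_one (l r) with h0 | h1
    · have := key 0 hH.zero
      rwa [zero_add, hlam, h0, add_zero] at this
    · refine absurd ?_ hcount
      set t := P (permAct ρ r) with ht
      have htH : t ∈ H := hPG _ (hρ _ hr)
      rw [h1] at key
      refine Set.ncard_congr (fun y _ => y + t) ?_ ?_ ?_
      · rintro y ⟨hy, hy0⟩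
        exact ⟨hH.add hy htH, by rw [key y hy, hy0, zero_add]⟩
      · intro a b _ _ hab
        exact add_right_cancel hab
      · rintro y ⟨hy, hy1⟩
        refine ⟨y + t, ⟨hH.add hy htH, ?_⟩, ?_⟩
        · rw [key y hy, hy1]
          rfl
        · rw [add_assoc, F.add_self, add_zero]
  have hker : ∀ j, P (Pi.single j 1) = 0 → P (Pi.single (ρ j) 1) = 0 := by
    intro j hj
    by_contra hne
    obtain ⟨i, hi⟩ := (hPu (ρ j)).resolve_left hne
    obtain ⟨-, x, hx, hx1⟩ := hpierce i
    have hsub : ∃ r, (r ∈ G ∧ P r = 0) ∧ P (permAct ρ r) = x := by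
      refine Submodule.span_induction
        (p := fun x _ => ∃ r, (r ∈ G ∧ P r = 0) ∧ P (permAct ρ r) = x) ?_ ?_ ?_ ?_ hx
      · rintro x ⟨hxH, hx3, hxi⟩
        obtain ⟨a, b, rfl⟩ := exists_eq_three_singles hx3 hxi
        obtain ⟨a', ha'⟩ := hPs a
        have hja : j ≠ ρ.symm a' := by
          rintro rfl
          rw [Equiv.apply_symm_apply, ha'] at hi
          cases single_one_inj hi
          rw [F.add_self, zero_add] at hxH
          exact hH.single_notMem b hxH
        obtain ⟨k, hk⟩ := hG.exists_triple hja
        refine ⟨_, ⟨hk, ?_⟩, ?_⟩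
        · have := hPG _ hk
          simp only [map_add, hj, zero_add] at this ⊢
          rw [hH.eq_of_add_mem (hPu _) (hPu _) this, F.add_self]
        · have := hH.add hxH (hPG _ (hρ _ hk))
          simp only [permAct_add, permAct_single, map_add, Equiv.apply_symm_apply, hi, ha']
            at this ⊢
          rw [add_add_add_comm, F.add_self, zero_add] at this
          rw [hH.eq_of_add_mem (IsUnitOrZero.single b) (hPu _) this]
      · exact ⟨0, ⟨hG.zero, map_zero P⟩, map_zero (P ∘ₗ permLin ρ)⟩
      · rintro x y - - ⟨r, ⟨hr, hr0⟩, rfl⟩ ⟨s, ⟨hs, hs0⟩, rfl⟩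
        exact ⟨r + s, ⟨hG.add hr hs, by rw [map_add, hr0, hs0, add_zero]⟩,
          by rw [permAct_add, map_add]⟩
      · rintro c x - ⟨r, ⟨hr, hr0⟩, rfl⟩
        rcases ZMod.two_eq_zero_or_one c with rfl | rfl
        · exact ⟨0, ⟨hG.zero, map_zero P⟩, by
            rw [zero_smul]
            exact map_zero (P ∘ₗ permLin ρ)⟩
        · exact ⟨r, ⟨hr, hr0⟩, (one_smul _ _).symm⟩
    obtain ⟨r, ⟨hr, hr0⟩, rfl⟩ := hsub
    rw [hper r hr hr0] at hx1
    exact zero_ne_one hx1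
  have hker' : ∀ j, P (Pi.single (ρ j) 1) = 0 → P (Pi.single j 1) = 0 := fun j hj => by
    have := Equiv.Perm.perm_symm_mapsTo_of_mapsTo ρ
      (s := {j | P (Pi.single j 1) = 0}) hker hj
    simpa using this
  have hfib : ∀ j k, P (Pi.single j 1) = P (Pi.single k 1) →
      P (Pi.single (ρ j) 1) = P (Pi.single (ρ k) 1) := by
    intro j k hjk
    by_cases hne : j = k
    · rw [hne]
    obtain ⟨m, hm⟩ := hG.exists_triple hne
    have h1 := hPG _ hm
    rw [map_add, map_add, hjk, F.add_self] at h1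
    have h2 := hPG _ (hρ _ hm)
    rw [permAct_add, permAct_add, permAct_single, permAct_single, permAct_single, map_add,
      map_add, hker m (hH.eq_of_add_mem (Or.inl rfl) (hPu m) h1).symm, add_zero] at h2
    exact hH.eq_of_add_mem (hPu _) (hPu _) h2
  choose g hg using hPs
  have hex : ∀ i, ∃ i', P (Pi.single (ρ (g i)) 1) = Pi.single i' 1 := fun i => by
    refine (hPu _).resolve_left fun h0 => ?_
    have := hker' _ h0
    rw [hg] at this
    simpa using congrFun this i
  choose r hr using hex
  have hsurj : Function.Surjective r := fun i' => by
    have h1 : P (Pi.single (ρ (ρ.symm (g i'))) 1) = Pi.single i' 1 := by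
      rw [Equiv.apply_symm_apply, hg]
    rcases hPu (ρ.symm (g i')) with h0 | ⟨i, hi⟩
    · rw [hker _ h0] at h1
      simpa using (congrFun h1 i').symm
    · rw [← hg i] at hi
      rw [hfib _ _ hi, hr] at h1
      exact ⟨i, single_one_inj h1⟩
  set σ : Equiv.Perm κ :=
    Equiv.ofBijective r ⟨Finite.injective_iff_surjective.mpr hsurj, hsurj⟩ with hσ
  have hcomm : ∀ w, P (permAct ρ w) = permAct σ (P w) := permAct_comm P ρ σ fun j => by
    rcases hPu j with h0 | ⟨i, hi⟩
    · rw [hker j h0, h0]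
      rfl
    · rw [hi, permAct_single, hfib j (g i) (hi.trans (hg i).symm), hr]
      rfl
  refine ⟨hPG z hz, σ, l ∘ₗ E, fun y hy => ?_⟩
  obtain ⟨h1, h2⟩ := hl _ (hEH y hy)
  have h3 := hPG _ h1
  rw [hcomm, hPE] at h3
  refine ⟨h3, ?_⟩
  simpa only [Function.comp_apply, LinearMap.comp_apply, map_add, hcomm, hPE] using h2

end Descent

section Iteration

/-- The iterated projection `F^N → F^n`. -/
def foldIter (n : ℕ) : ∀ s, F (HType n s) →ₗ[ZMod 2] F (Fin n)
  | 0 => LinearMap.id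
  | s + 1 => foldIter n s ∘ₗ fold

/-- The iterated embedding `F^n → F^N`. -/
def embedIter (n : ℕ) : ∀ s, F (Fin n) →ₗ[ZMod 2] F (HType n s)
  | 0 => LinearMap.id
  | s + 1 => embedLeft ∘ₗ embedIter n s

variable {n : ℕ} {H : Set (F (Fin n))}

theorem isHam_Hcode (hH : IsHam H) : ∀ s, IsHam (Hcode n H s)
  | 0 => hH
  | s + 1 => (isHam_Hcode hH s).vasiliev

theorem foldIter_embedIter (y : F (Fin n)) : ∀ s, foldIter n s (embedIter n s y) = y
  | 0 => rfl
  | s + 1 => by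
    change foldIter n s (fold (vasVec (embedIter n s y) 0 0)) = y
    rw [fold_vasVec, add_zero, foldIter_embedIter y s]

theorem foldIter_mem : ∀ s, ∀ w ∈ Hcode n H s, foldIter n s w ∈ H
  | 0, _, hw => hw
  | s + 1, _, hw => foldIter_mem s _ (mem_Vasiliev.mp hw).1

theorem embedIter_mem {y : F (Fin n)} (hy : y ∈ H) : ∀ s, embedIter n s y ∈ Hcode n H s
  | 0 => hy
  | s + 1 => mem_Vasiliev.mpr (by
    change fold (vasVec (embedIter n s y) 0 0) ∈ _ ∧ (0 : ZMod 2) = wt 0 + 0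
    rw [fold_vasVec, add_zero, wt_zero]
    exact ⟨embedIter_mem hy s, rfl⟩)

theorem isUnitOrZero_foldIter_single :
    ∀ (s : ℕ) (j : HType n s), IsUnitOrZero (foldIter n s (Pi.single j 1))
  | 0, j => IsUnitOrZero.single j
  | s + 1, j => by
    change IsUnitOrZero (foldIter n s (fold (Pi.single (M := fun _ => ZMod 2) j 1)))
    rcases isUnitOrZero_fold_single j with h | ⟨i, h⟩
    · exact Or.inl (by rw [h, map_zero])
    · rw [h]
      exact isUnitOrZero_foldIter_single s i

theorem exists_foldIter_single (i : Fin n) :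
    ∀ s, ∃ j : HType n s, foldIter n s (Pi.single j 1) = Pi.single i 1
  | 0 => ⟨i, rfl⟩
  | s + 1 => by
    obtain ⟨j, hj⟩ := exists_foldIter_single i s
    refine ⟨Sum.inl j, ?_⟩
    rw [← hj]
    exact congrArg (foldIter n s) (fold_single_inl j)

theorem lamIter_eq (lam : F (Fin n) → ZMod 2) : ∀ s, lamIter n lam s = lam ∘ foldIter n s
  | 0 => rfl
  | s + 1 => by
    change lamSucc (lamIter n lam s) = _
    rw [lamIter_eq lam s]
    rfl

end Iteration

/-- description of `T_N` for all lengths `N > n` in the recursion. -/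
theorem stmt5 {n : ℕ} (H : Set (F (Fin n))) (hH : IsHammingCode H)
    (lam : F (Fin n) → ZMod 2) (hlam : lam 0 = 0)
    (hnl : ∃ y₁ ∈ H, ∃ y₂ ∈ H, lam (y₁ + y₂) ≠ lam y₁ + lam y₂)
    (hpierce : ∀ j : Fin n, Pierces lam (component H j))
    (hcount : {y ∈ H | lam y = 0}.ncard ≠ {y ∈ H | lam y = 1}.ncard) :
    ∀ s : ℕ, Tset (Hcode n H (s + 1)) (lamIter n lam (s + 1)) =
      {z | ∃ y ∈ Tset (Hcode n H s) (lamIter n lam s),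
        ∃ v ∈ Rmid, z = vasVec y 0 0 + v} := by
  have hHam := hH.isHam
  have hchar : ∀ s z, z ∈ Tset (Hcode n H s) (lamIter n lam s) ↔
      IsRotation (Hcode n H s) (lamIter n lam s) z := by
    refine fun s z => ⟨isRotation_of_mem_Tset (isHam_Hcode hHam s) ?_ ?_,
      IsRotation.mem_Tset (isHam_Hcode hHam s)⟩
    · rw [lamIter_eq, Function.comp_apply, map_zero, hlam]
    obtain ⟨y₁, h₁, y₂, h₂, hne⟩ := hnl
    refine ⟨_, embedIter_mem h₁ s, _, embedIter_mem h₂ s, ?_⟩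
    simpa [lamIter_eq, foldIter_embedIter] using hne
  have hlift : ∀ s z, z ∈ Hcode n H s → IsRotation H lam (foldIter n s z) →
      IsRotation (Hcode n H s) (lamIter n lam s) z := by
    intro s
    induction s with
    | zero => exact fun _ _ h => h
    | succ s ih => exact fun z hz h => IsRotation.lift hz (ih _ (mem_Vasiliev.mp hz).1 h)
  have hmem : ∀ s z, z ∈ Tset (Hcode n H s) (lamIter n lam s) ↔
      z ∈ Hcode n H s ∧ IsRotation H lam (foldIter n s z) := by
    intro s z
    rw [hchar]
    refine ⟨fun h => ⟨h.1, ?_⟩, fun h => hlift s z h.1 h.2⟩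
    rw [lamIter_eq] at h
    exact h.descend (isHam_Hcode hHam s) hHam (fun y => foldIter_embedIter y s) (foldIter_mem s)
      (fun y hy => embedIter_mem hy s) (isUnitOrZero_foldIter_single s)
      (fun i => exists_foldIter_single i s) hlam hpierce hcount
  intro s
  ext z
  have hfold : ∀ (x y : F (HType n s)) (b : ZMod 2),
      foldIter n (s + 1) (vasVec (x + y) b x) = foldIter n s y := fun x y b => by
    change foldIter n s (fold (vasVec (x + y) b x)) = _
    rw [fold_vasVec, add_comm, F.add_cancel_left]
  have hsplit : ∀ (x y : F (HType n s)),
      vasVec y 0 0 + vasVec x (wt x) x = vasVec (x + y) (wt x + 0) x := fun x y => by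
    funext j
    rcases j with j | j | j <;> simp [vasVec, add_comm]
  rw [hmem]
  constructor
  · rintro ⟨⟨x, y, hy, rfl⟩, hrot⟩
    exact ⟨y, (hmem s y).mpr ⟨hy, hfold x y _ ▸ hrot⟩, _, ⟨x, rfl⟩, (hsplit x y).symm⟩
  · rintro ⟨y, hy, v, ⟨x, rfl⟩, hz⟩
    obtain ⟨hyH, hrot⟩ := (hmem s y).mp hy
    obtain rfl := hz.trans (hsplit x y)
    exact ⟨⟨x, y, hyH, rfl⟩, (hfold x y _).symm ▸ hrot⟩
end

section
/- Let C be a reduced perfect code of length n, λ: C → ZMod 2 with λ(0^n) = 0, and let z = (x+y, |x|+λ(y), x) ∈ V_C^λ with x ∈ F^n, y ∈ C. Then STS(V_C^λ, z) = (STS(C,y))^θ, where θ: STS(C,y) → {0,1} is defined by θ(supp(y + y')) = λ(y) + λ(y') for y' ∈ C with d(y, y') = 3. -/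
set_option linter.unusedSectionVars false

section BinaryVectors

variable {ι : Type*}

theorem binary_add_self (u : F ι) : u + u = 0 := by
  funext i
  exact CharTwo.add_self_eq_zero (u i)

theorem binary_add_add_cancel_left (u w : F ι) : u + (u + w) = w := by
  rw [← add_assoc, binary_add_self, zero_add]

theorem supp_vasVec_left (w : F ι) : supp (vasVec w 0 0) = Sum.inl '' supp w := by
  ext (i | j | i) <;> simp [supp, vasVec]

theorem supp_vasVec_right (w : F ι) :
    supp (vasVec 0 0 w) = (fun i => Sum.inr (Sum.inr i)) '' supp w := by
  ext (i | j | i) <;> simp [supp, vasVec]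

variable [DecidableEq ι]

theorem supp_vasVec_single_middle (i : ι) :
    supp (vasVec (Pi.single i 1) 1 (Pi.single i 1)) =
      {Sum.inl i, Sum.inr (Sum.inl ()), Sum.inr (Sum.inr i)} := by
  ext (j | j | j) <;> simp [supp, vasVec, Pi.single_apply]

theorem add_single_apply_ne_zero_iff {w : F ι} {a : ι} (ha : w a ≠ 0) (j : ι) :
    (w + Pi.single a 1 : F ι) j ≠ 0 ↔ w j ≠ 0 ∧ j ≠ a := by
  by_cases h : j = a
  · subst h
    have key : ∀ t : ZMod 2, t ≠ 0 → t + 1 = 0 := by decide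
    simp [key _ ha]
  · simp [h]

theorem supp_vasVec_single_left {w : F ι} {a : ι} (ha : w a ≠ 0) :
    supp (vasVec (Pi.single a 1) 0 (w + Pi.single a 1)) =
      insert (Sum.inl a) ((fun i => Sum.inr (Sum.inr i)) '' (supp w \ {a})) := by
  ext (j | j | j)
  · simp [supp, vasVec, Pi.single_apply]
  · simp [supp, vasVec]
  · simpa [supp, vasVec] using add_single_apply_ne_zero_iff ha j

theorem supp_vasVec_single_right {w : F ι} {a : ι} (ha : w a ≠ 0) :
    supp (vasVec (w + Pi.single a 1) 0 (Pi.single a 1)) =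
      insert (Sum.inr (Sum.inr a)) (Sum.inl '' (supp w \ {a})) := by
  ext (j | j | j)
  · simpa [supp, vasVec] using add_single_apply_ne_zero_iff ha j
  · simp [supp, vasVec]
  · simp [supp, vasVec, Pi.single_apply]

variable [Fintype ι]

theorem hammingDist_eq_hammingNorm_add (u w : F ι) :
    hammingDist u w = hammingNorm (u + w) := by
  rw [hammingDist_eq_hammingNorm]
  congr 1
  funext i
  exact congrArg (· + w i) (CharTwo.neg_eq (u i))

theorem hammingNorm_eq_sum (u : F ι) :
    hammingNorm u = ∑ i, if u i ≠ 0 then 1 else 0 := by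
  rw [hammingNorm, Finset.card_filter]

theorem hammingNorm_vasVec (a : F ι) (b : ZMod 2) (c : F ι) :
    hammingNorm (vasVec a b c) =
      hammingNorm a + (if b ≠ 0 then 1 else 0) + hammingNorm c := by
  simp only [hammingNorm_eq_sum, Fintype.sum_sum_type, vasVec, Sum.elim_inl, Sum.elim_inr,
    Finset.univ_unique, Finset.sum_singleton, add_assoc]
  congr

theorem natCast_hammingNorm (u : F ι) : (hammingNorm u : ZMod 2) = wt u := by
  rw [hammingNorm_eq_sum, wt, Nat.cast_sum]
  refine Finset.sum_congr rfl fun i _ => ?_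
  have key : ∀ t : ZMod 2, (((if t ≠ 0 then 1 else 0 : ℕ)) : ZMod 2) = t := by decide
  exact key (u i)

theorem hammingNorm_le_add (u w : F ι) :
    hammingNorm w ≤ hammingNorm u + hammingNorm (u + w) := by
  have h := hammingDist_triangle w u 0
  rw [hammingDist_zero_right, hammingDist_zero_right, hammingDist_eq_hammingNorm_add,
    add_comm w u] at h
  omega

theorem hammingNorm_eq_add_iff (u w : F ι) :
    hammingNorm w = hammingNorm u + hammingNorm (u + w) ↔ ∀ i, u i ≠ 0 → w i ≠ 0 := by
  have hle : ∀ s t : ZMod 2, (if t ≠ 0 then 1 else 0) ≤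
      (if s ≠ 0 then 1 else 0) + (if s + t ≠ 0 then 1 else 0) := by decide
  have heq : ∀ s t : ZMod 2, (if t ≠ 0 then 1 else 0) =
      (if s ≠ 0 then 1 else 0) + (if s + t ≠ 0 then 1 else 0) ↔ (s ≠ 0 → t ≠ 0) := by decide
  rw [hammingNorm_eq_sum, hammingNorm_eq_sum u, hammingNorm_eq_sum (u + w),
    ← Finset.sum_add_distrib, Finset.sum_eq_sum_iff_of_le fun i _ => by exact hle (u i) (w i)]
  exact ⟨fun h i => (heq _ _).1 (h i (Finset.mem_univ i)), fun h i _ => (heq _ _).2 (h i)⟩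

theorem hammingNorm_single (a : ι) : hammingNorm (Pi.single a 1 : F ι) = 1 := by
  simp [hammingNorm_eq_sum, Pi.single_apply]

theorem exists_eq_single_of_hammingNorm_eq_one {u : F ι} (h : hammingNorm u = 1) :
    ∃ a, u = Pi.single a 1 := by
  obtain ⟨a, ha⟩ := Finset.card_eq_one.1 h
  refine ⟨a, funext fun i => ?_⟩
  have key : ∀ t : ZMod 2, t ≠ 0 → t = 1 := by decide
  have hi : u i ≠ 0 ↔ i = a := by simpa using Finset.ext_iff.1 ha i
  by_cases h : i = a
  · subst h
    simpa using key _ (hi.2 rfl)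
  · simpa [h] using hi.not.2 h

theorem hammingNorm_add_single {w : F ι} {a : ι} (ha : w a ≠ 0) :
    hammingNorm (w + Pi.single a 1) + 1 = hammingNorm w := by
  rw [(hammingNorm_eq_add_iff (Pi.single a 1) w).2 ?_, hammingNorm_single,
    add_comm w, add_comm]
  intro i hi
  by_cases h : i = a
  · rwa [h]
  · simp [h] at hi

theorem IsPerfect.three_le_hammingDist {C : Set (F ι)} (hC : IsPerfect C) {c d : F ι}
    (hc : c ∈ C) (hd : d ∈ C) (hne : c ≠ d) : 3 ≤ hammingDist c d := by
  by_contra! hlt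
  obtain ⟨i, hi⟩ : ∃ i, c i ≠ d i := Function.ne_iff.1 hne
  have hw : (c + d) i ≠ 0 := by
    rwa [Pi.add_apply, ← CharTwo.sub_eq_add, sub_ne_zero]
  have hnorm := hammingNorm_add_single hw
  rw [← hammingDist_eq_hammingNorm_add c d] at hnorm
  refine hne ((hC (c + Pi.single i 1)).unique ⟨hc, ?_⟩ ⟨hd, ?_⟩)
  · rw [hammingDist_comm, hammingDist_eq_hammingNorm_add, binary_add_add_cancel_left,
      hammingNorm_single]
  · rw [hammingDist_eq_hammingNorm_add, add_right_comm]
    omega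

theorem vasVec_add_vasVec (a a' : F ι) (b b' : ZMod 2) (c c' : F ι) :
    vasVec a b c + vasVec a' b' c' = vasVec (a + a') (b + b') (c + c') := by
  funext i
  rcases i with i | i | i <;> rfl

/-- The blocks of the Steiner triple system of a Vasil'ev code, described by the differences
`u = x + x'` and `w = y + y'`. -/
theorem mem_STS_vasiliev_iff (C : Set (F ι)) (lam : F ι → ZMod 2) (x y : F ι)
    (T : Set (ι ⊕ Unit ⊕ ι)) :
    T ∈ STS (Vasiliev C lam) (vasVec (x + y) (wt x + lam y) x) ↔
      ∃ u w : F ι, y + w ∈ C ∧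
        hammingNorm (vasVec (u + w) (wt u + (lam y + lam (y + w))) u) = 3 ∧
        T = supp (vasVec (u + w) (wt u + (lam y + lam (y + w))) u) := by
  have hdiff : ∀ x' y' : F ι,
      vasVec (x' + y') (wt x' + lam y') x' + vasVec (x + y) (wt x + lam y) x =
        vasVec ((x + x') + (y + y')) (wt (x + x') + (lam y + lam y')) (x + x') := by
    intro x' y'
    have hwt : wt (x + x') = wt x + wt x' := by simp [wt, Finset.sum_add_distrib]
    rw [vasVec_add_vasVec, hwt]
    congr 1 <;> abel
  constructor
  · rintro ⟨_, ⟨x', y', hy', rfl⟩, hd, rfl⟩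
    rw [hammingDist_eq_hammingNorm_add, hdiff] at hd
    rw [hdiff]
    exact ⟨x + x', y + y', by simpa only [binary_add_add_cancel_left] using hy',
      by simpa only [binary_add_add_cancel_left] using hd,
      by simp only [binary_add_add_cancel_left]⟩
  · rintro ⟨u, w, hw, hn, rfl⟩
    refine ⟨_, ⟨x + u, y + w, hw, rfl⟩, ?_, ?_⟩
    · rw [hammingDist_eq_hammingNorm_add, hdiff]
      simpa only [binary_add_add_cancel_left] using hn
    · rw [hdiff]
      simp only [binary_add_add_cancel_left]

theorem STS_vasiliev_eq_AM {C : Set (F ι)} (hC : IsPerfect C) (lam : F ι → ZMod 2)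
    (x : F ι) {y : F ι} (hy : y ∈ C) (θ : Set ι → ZMod 2)
    (hθ : ∀ y' ∈ C, hammingDist y' y = 3 → θ (supp (y + y')) = lam y + lam y') :
    STS (Vasiliev C lam) (vasVec (x + y) (wt x + lam y) x) = AM (STS C y) θ := by
  ext T
  rw [mem_STS_vasiliev_iff]
  constructor
  · rintro ⟨u, w, hw, hn, rfl⟩
    by_cases hw0 : w = 0
    · subst hw0
      simp only [add_zero, CharTwo.add_self_eq_zero, hammingNorm_vasVec] at hn ⊢
      split_ifs at hn with hb
      · obtain ⟨i, rfl⟩ := exists_eq_single_of_hammingNorm_eq_one (u := u) (by omega)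
        have h1 : wt (Pi.single i 1 : F ι) = 1 := by
          rw [← natCast_hammingNorm, hammingNorm_single, Nat.cast_one]
        exact Or.inl ⟨i, by rw [h1, supp_vasVec_single_middle]⟩
      · omega
    · have hd : hammingDist (y + w) y = hammingNorm w := by
        rw [hammingDist_comm, hammingDist_eq_hammingNorm_add, binary_add_add_cancel_left]
      have h3 := hC.three_le_hammingDist hw hy (by simpa using hw0)
      have hle := hammingNorm_le_add u w
      rw [hammingNorm_vasVec] at hn
      split_ifs at hn with hb
      · omega
      rw [not_not] at hb
      have hw3 : hammingNorm w = 3 := by omega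
      have hmem : supp w ∈ STS C y :=
        ⟨y + w, hw, hd.trans hw3, by rw [add_comm, binary_add_add_cancel_left]⟩
      have hθw : θ (supp w) = wt u := by
        have h := hθ _ hw (hd.trans hw3)
        rw [binary_add_add_cancel_left] at h
        rw [h]
        exact (CharTwo.add_eq_zero.1 hb).symm
      have hsub := (hammingNorm_eq_add_iff u w).1 (by omega)
      have hsub' := (hammingNorm_eq_add_iff (u + w) w).1 (by
        rw [add_assoc, binary_add_self, add_zero]
        omega)
      rw [← natCast_hammingNorm] at hθw
      rw [hb]
      have hcases : hammingNorm u = 0 ∨ hammingNorm u = 1 ∨ hammingNorm (u + w) = 1 ∨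
          hammingNorm (u + w) = 0 := by omega
      rcases hcases with h | h | h | h
      · rw [h] at hθw
        rw [hammingNorm_eq_zero.1 h, zero_add]
        exact Or.inr (Or.inl ⟨_, hmem, hθw, Or.inl (supp_vasVec_left w)⟩)
      · rw [h] at hθw
        obtain ⟨a, rfl⟩ := exists_eq_single_of_hammingNorm_eq_one h
        have ha : w a ≠ 0 := hsub a (by simp)
        rw [add_comm]
        exact Or.inr (Or.inr ⟨_, hmem, hθw, Or.inr ⟨a, ha, supp_vasVec_single_right ha⟩⟩)
      · have hu : hammingNorm u = 2 := by omega
        rw [hu] at hθw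
        obtain ⟨a, hs⟩ := exists_eq_single_of_hammingNorm_eq_one h
        have ha : w a ≠ 0 := hsub' a (by rw [hs]; simp)
        have hu' : u = w + Pi.single a 1 := by
          rw [← hs, add_comm u, binary_add_add_cancel_left]
        rw [hs, hu']
        exact Or.inr (Or.inl ⟨_, hmem, hθw, Or.inr ⟨a, ha, supp_vasVec_single_left ha⟩⟩)
      · have hu : hammingNorm u = 3 := by omega
        rw [hu] at hθw
        have hs := hammingNorm_eq_zero.1 h
        have hu' : u = w := by
          rw [← add_zero w, ← hs, add_comm u, binary_add_add_cancel_left]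
        rw [hs, hu']
        exact Or.inr (Or.inr ⟨_, hmem, hθw, Or.inl (supp_vasVec_right w)⟩)
  · have main : ∀ y' ∈ C, hammingDist y' y = 3 → ∀ u : F ι,
        hammingNorm (u + (y' + y)) + hammingNorm u = 3 →
        θ (supp (y' + y)) = hammingNorm u →
        T = supp (vasVec (u + (y' + y)) 0 u) →
        ∃ u w : F ι, y + w ∈ C ∧
          hammingNorm (vasVec (u + w) (wt u + (lam y + lam (y + w))) u) = 3 ∧
          T = supp (vasVec (u + w) (wt u + (lam y + lam (y + w))) u) := by
      intro y' hy' hd u hn hu hT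
      have hyw : y + (y' + y) = y' := by rw [add_comm y', binary_add_add_cancel_left]
      have hb : wt u + (lam y + lam (y + (y' + y))) = 0 := by
        rw [hyw, ← hθ y' hy' hd, add_comm y, hu, natCast_hammingNorm,
          CharTwo.add_self_eq_zero]
      refine ⟨u, y' + y, by rwa [hyw], ?_, ?_⟩
      · rw [hb, hammingNorm_vasVec]
        simpa using hn
      · rw [hb, hT]
    rintro (⟨i, rfl⟩ | ⟨_, ⟨y', hy', hd, rfl⟩, h0, h⟩ | ⟨_, ⟨y', hy', hd, rfl⟩, h1, h⟩)
    · have h1 : wt (Pi.single i 1 : F ι) = 1 := by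
        rw [← natCast_hammingNorm, hammingNorm_single, Nat.cast_one]
      refine ⟨Pi.single i 1, 0, by rwa [add_zero], ?_, ?_⟩
      · simp [hammingNorm_vasVec, h1, CharTwo.add_self_eq_zero, hammingNorm_single]
      · simp only [add_zero, CharTwo.add_self_eq_zero, h1, supp_vasVec_single_middle]
    all_goals
      have hw3 : hammingNorm (y' + y) = 3 := by rw [← hammingDist_eq_hammingNorm_add, hd]
    · rcases h with rfl | ⟨a, ha, rfl⟩
      · refine main y' hy' hd 0 ?_ ?_ ?_
        · rw [zero_add, hw3, hammingNorm_zero]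
        · rw [h0, hammingNorm_zero, Nat.cast_zero]
        · rw [zero_add, supp_vasVec_left]
      · have hu := hammingNorm_add_single ha
        have hs : y' + y + Pi.single a 1 + (y' + y) = Pi.single a 1 := by
          rw [add_comm, binary_add_add_cancel_left]
        refine main y' hy' hd (y' + y + Pi.single a 1) ?_ ?_ ?_
        · rw [hs, hammingNorm_single]
          omega
        · rw [h0, show hammingNorm (y' + y + Pi.single a 1) = 2 by omega]
          rfl
        · rw [hs, supp_vasVec_single_left ha]
    · rcases h with rfl | ⟨a, ha, rfl⟩
      · refine main y' hy' hd (y' + y) ?_ ?_ ?_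
        · rw [binary_add_self, hw3, hammingNorm_zero]
        · rw [h1, hw3]
          rfl
        · rw [binary_add_self, supp_vasVec_right]
      · have hu := hammingNorm_add_single ha
        refine main y' hy' hd (Pi.single a 1) ?_ ?_ ?_
        · rw [add_comm (Pi.single a 1), hammingNorm_single]
          omega
        · rw [h1, hammingNorm_single, Nat.cast_one]
        · rw [add_comm (Pi.single a 1), supp_vasVec_single_right ha]

end BinaryVectors

/-- `STS(V_C^λ, z) = STS(C, y)^θ` for `z = (x+y, |x|+λ(y), x)`,
with `θ(supp(y + y')) = λ(y) + λ(y')`. -/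
theorem stmt8 {n : ℕ} (C : Set (F (Fin n))) (h0 : (0 : F (Fin n)) ∈ C)
    (hC : IsPerfect C) (lam : F (Fin n) → ZMod 2) (hlam : lam 0 = 0)
    (x y : F (Fin n)) (hy : y ∈ C) (θ : Set (Fin n) → ZMod 2)
    (hθ : ∀ y' ∈ C, hammingDist y' y = 3 → θ (supp (y + y')) = lam y + lam y') :
    STS (Vasiliev C lam) (vasVec (x + y) (wt x + lam y) x) = AM (STS C y) θ := by
  exact STS_vasiliev_eq_AM hC lam x hy θ hθ
end
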